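/- (Annihilation/lowering operator.) Let n ≥ 2 be an integer and i ∈ {1,2}. For every real x at which all rational functions appearing are defined, Θ̃_n(x) · 𝒟_i Q_n^{(i)}(x) + Λ_{2,n}^{(1)}(x) · Q_n^{(i)}(x) = Λ_{1,n}^{(1)}(x) · Q_{n−1}^{(i)}(x). -/

import Mathlib

open Finset Filter Topology Polynomial

noncomputable section

/-- Pochhammer symbol `(a)_k = a(a+1)⋯(a+k−1)`. -/
def poch (a : ℝ) (k : ℕ) : ℝ := ∏ m ∈ Finset.range k, (a + m)

/-- Falling factorial `[x]_k = x(x−1)⋯(x−k+1)`. -/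
def fall (x : ℝ) (k : ℕ) : ℝ := ∏ m ∈ Finset.range k, (x - m)

/-- `⟨x⟩_i^k`: falling factorial for `i = 1`, Pochhammer symbol for `i = 2`. -/
def br (i : ℕ) (x : ℝ) (k : ℕ) : ℝ := if i = 1 then fall x k else poch x k

/-- Forward (`i = 1`) resp. backward (`i = 2`) difference operator `𝒟_i`. -/
def Dop (i : ℕ) (f : ℝ → ℝ) : ℝ → ℝ :=
  fun x => if i = 1 then f (x + 1) - f x else f x - f (x - 1)

/-- Iterated difference operator `𝒟_i^k`. -/
def Dk (i k : ℕ) (f : ℝ → ℝ) : ℝ → ℝ := (Dop i)^[k] f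

/-- Kronecker delta `δ_{i,m}` (real valued). -/
def kdelta (i m : ℕ) : ℝ := if i = m then 1 else 0

/-- The shift `x ± 1`: `x + 1` for `i = 1`, `x - 1` for `i = 2`. -/
def sh (i : ℕ) (x : ℝ) : ℝ := if i = 1 then x + 1 else x - 1

/-- Monic Meixner polynomial `M_n(x)`. -/
def MeixnerM (γ μ : ℝ) (n : ℕ) (x : ℝ) : ℝ :=
  poch γ n * (μ / (μ - 1)) ^ n *
    ∑ k ∈ Finset.range (n + 1),
      poch (-(n : ℝ)) k * poch (-x) k / poch γ k * (1 - μ⁻¹) ^ k / (Nat.factorial k : ℝ)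

/-- Meixner inner product `⟨p,q⟩ = ∑_{x≥0} p(x)q(x) μ^x (γ)_x / x!`. -/
def mIP (γ μ : ℝ) (p q : ℝ → ℝ) : ℝ :=
  ∑' x : ℕ, p x * q x * μ ^ x * poch γ x / (Nat.factorial x : ℝ)

/-- Squared Meixner norm `‖M_n‖²`. -/
def nrm2 (γ μ : ℝ) (n : ℕ) : ℝ := mIP γ μ (MeixnerM γ μ n) (MeixnerM γ μ n)

/-- Kernel `K_n^{(l,m)}(x,y)` for the operator `𝒟_i`. -/
def Klm (γ μ : ℝ) (i l m n : ℕ) (x y : ℝ) : ℝ :=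
  ∑ k ∈ Finset.range (n + 1),
    Dk i l (MeixnerM γ μ k) x * Dk i m (MeixnerM γ μ k) y / nrm2 γ μ k

/-- Sobolev inner product `⟨p,q⟩_λ = ⟨p,q⟩ + λ 𝒟_i^j p(α) 𝒟_i^j q(α)`. -/
def sIP (γ μ lam α : ℝ) (i j : ℕ) (p q : ℝ → ℝ) : ℝ :=
  mIP γ μ p q + lam * Dk i j p α * Dk i j q α

/-- `Q` is the monic Sobolev orthogonal polynomial of degree `n`. -/
def IsSobolevOP (γ μ lam α : ℝ) (i j n : ℕ) (Q : Polynomial ℝ) : Prop :=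
  Q.Monic ∧ Q.natDegree = n ∧
    ∀ p : Polynomial ℝ, p.degree < (n : WithBot ℕ) →
      sIP γ μ lam α i j (fun x => Q.eval x) (fun x => p.eval x) = 0

/-- Coefficient `a_n^{(k)}`. -/
def acoef (γ μ lam α : ℝ) (i j n k : ℕ) : ℝ :=
  -(lam * (Nat.factorial j : ℝ) * Dk i j (MeixnerM γ μ n) α * Dk i k (MeixnerM γ μ (n - 1)) α) /
    ((Nat.factorial k : ℝ) * nrm2 γ μ (n - 1) * (1 + lam * Klm γ μ i j j (n - 1) α α))

/-- Coefficient `b_n^{(k)}`. -/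
def bcoef (γ μ lam α : ℝ) (i j n k : ℕ) : ℝ :=
  lam * (Nat.factorial j : ℝ) * Dk i j (MeixnerM γ μ n) α * Dk i k (MeixnerM γ μ n) α /
    ((Nat.factorial k : ℝ) * nrm2 γ μ (n - 1) * (1 + lam * Klm γ μ i j j (n - 1) α α))

/-- Rational function `A_{1,n}(x)`. -/
def A1 (γ μ lam α : ℝ) (i j n : ℕ) (x : ℝ) : ℝ :=
  1 + (1 / br i (x - α) (j + 1)) *
    ∑ k ∈ Finset.range (j + 1), acoef γ μ lam α i j n k * br i (x - α) k

/-- Rational function `B_{1,n}(x)`. -/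
def B1 (γ μ lam α : ℝ) (i j n : ℕ) (x : ℝ) : ℝ :=
  (1 / br i (x - α) (j + 1)) *
    ∑ k ∈ Finset.range (j + 1), bcoef γ μ lam α i j n k * br i (x - α) k

/-- Meixner recurrence coefficient `α_n`. -/
def alphaR (γ μ : ℝ) (n : ℕ) : ℝ := ((n : ℝ) * (1 + μ) + μ * γ) / (1 - μ)

/-- Meixner recurrence coefficient `β_n`. -/
def betaR (γ μ : ℝ) (n : ℕ) : ℝ := (n : ℝ) * μ * ((n : ℝ) + γ - 1) / (1 - μ) ^ 2

/-- Rational function `A_{2,n}(x)`. -/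
def A2 (γ μ lam α : ℝ) (i j n : ℕ) (x : ℝ) : ℝ :=
  -(B1 γ μ lam α i j (n - 1) x) / betaR γ μ (n - 1)

/-- Rational function `B_{2,n}(x)`. -/
def B2 (γ μ lam α : ℝ) (i j n : ℕ) (x : ℝ) : ℝ :=
  A1 γ μ lam α i j (n - 1) x + A2 γ μ lam α i j n x * (alphaR γ μ (n - 1) - x)

/-- Rational function `C_{1,n}(x)`. -/
def C1 (γ μ lam α : ℝ) (i j n : ℕ) (x : ℝ) : ℝ :=
  (x + γ * kdelta i 1) * Dop i (A1 γ μ lam α i j n) x + (n : ℝ) * A1 γ μ lam α i j n (sh i x)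
    - ((n : ℝ) - 1) * ((n : ℝ) + γ - 2) * μ ^ kdelta i 2 * B1 γ μ lam α i j n (sh i x) /
        (betaR γ μ (n - 1) * (1 - μ))

/-- Rational function `D_{1,n}(x)`. -/
def D1 (γ μ lam α : ℝ) (i j n : ℕ) (x : ℝ) : ℝ :=
  (x + γ * kdelta i 1) * Dop i (B1 γ μ lam α i j n) x
    + ((n : ℝ) - 1) * B1 γ μ lam α i j n (sh i x)
    + ((n : ℝ) - 1) * ((n : ℝ) + γ - 2) * (x - alphaR γ μ (n - 1)) * μ ^ kdelta i 2 *
        B1 γ μ lam α i j n (sh i x) / (betaR γ μ (n - 1) * (1 - μ))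
    + (n : ℝ) * ((n : ℝ) + γ - 1) * μ ^ kdelta i 2 * A1 γ μ lam α i j n (sh i x) / (1 - μ)

/-- Rational function `C_{2,n}(x)`. -/
def C2 (γ μ lam α : ℝ) (i j n : ℕ) (x : ℝ) : ℝ :=
  -(D1 γ μ lam α i j (n - 1) x) / betaR γ μ (n - 1)

/-- Rational function `D_{2,n}(x)`. -/
def D2 (γ μ lam α : ℝ) (i j n : ℕ) (x : ℝ) : ℝ :=
  C1 γ μ lam α i j (n - 1) x + C2 γ μ lam α i j n x * (alphaR γ μ (n - 1) - x)

/-- `A_{m,n}(x)` for `m = 1, 2`. -/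
def Aa (γ μ lam α : ℝ) (i j n m : ℕ) (x : ℝ) : ℝ :=
  if m = 1 then A1 γ μ lam α i j n x else A2 γ μ lam α i j n x

/-- `B_{m,n}(x)` for `m = 1, 2`. -/
def Bb (γ μ lam α : ℝ) (i j n m : ℕ) (x : ℝ) : ℝ :=
  if m = 1 then B1 γ μ lam α i j n x else B2 γ μ lam α i j n x

/-- `C_{k,n}(x)` for `k = 1, 2`. -/
def Cc (γ μ lam α : ℝ) (i j n k : ℕ) (x : ℝ) : ℝ :=
  if k = 1 then C1 γ μ lam α i j n x else C2 γ μ lam α i j n x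

/-- `D_{k,n}(x)` for `k = 1, 2`. -/
def Dd (γ μ lam α : ℝ) (i j n k : ℕ) (x : ℝ) : ℝ :=
  if k = 1 then D1 γ μ lam α i j n x else D2 γ μ lam α i j n x

/-- `Λ_{m,n}^{(k)}(x) = (−1)^k (C_{k,n}(x) B_{m,n}(x) − A_{m,n}(x) D_{k,n}(x))`. -/
def Lam (γ μ lam α : ℝ) (i j n m k : ℕ) (x : ℝ) : ℝ :=
  (-1 : ℝ) ^ k * (Cc γ μ lam α i j n k x * Bb γ μ lam α i j n m x
    - Aa γ μ lam α i j n m x * Dd γ μ lam α i j n k x)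

/-- `Θ_n(x) = A_{1,n}(x) B_{2,n}(x) − B_{1,n}(x) A_{2,n}(x)`. -/
def Theta (γ μ lam α : ℝ) (i j n : ℕ) (x : ℝ) : ℝ :=
  A1 γ μ lam α i j n x * B2 γ μ lam α i j n x - B1 γ μ lam α i j n x * A2 γ μ lam α i j n x

/-- `Θ̃_n(x) = (x + γ δ_{i,1}) Θ_n(x)`. -/
def Thetatil (γ μ lam α : ℝ) (i j n : ℕ) (x : ℝ) : ℝ :=
  (x + γ * kdelta i 1) * Theta γ μ lam α i j n x

/-- The forward/backward difference operator as a linear map. -/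
def dopLinear (i : ℕ) : (ℝ → ℝ) →ₗ[ℝ] (ℝ → ℝ) where
  toFun := Dop i
  map_add' f g := by
    funext x
    simp only [Dop, Pi.add_apply]
    split_ifs <;> ring
  map_smul' c f := by
    funext x
    simp only [Dop, Pi.smul_apply, smul_eq_mul, RingHom.id_apply]
    split_ifs <;> ring

lemma Dk_eq_dopLinear_pow (i k : ℕ) (f : ℝ → ℝ) : Dk i k f = (dopLinear i ^ k) f := by
  rw [Module.End.pow_apply]
  rfl

lemma Dk_succ (i k : ℕ) (f : ℝ → ℝ) : Dk i (k + 1) f = Dop i (Dk i k f) :=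
  Function.iterate_succ_apply' _ _ _

lemma Dk_sub (i k : ℕ) (f g : ℝ → ℝ) (y : ℝ) :
    Dk i k (fun t => f t - g t) y = Dk i k f y - Dk i k g y := by
  have h : (fun t => f t - g t) = f - g := rfl
  simp only [Dk_eq_dopLinear_pow, h, map_sub, Pi.sub_apply]

lemma Dk_const_mul (i k : ℕ) (c : ℝ) (f : ℝ → ℝ) (y : ℝ) :
    Dk i k (fun t => c * f t) y = c * Dk i k f y := by
  have h : (fun t => c * f t) = c • f := rfl
  simp only [Dk_eq_dopLinear_pow, h, map_smul, Pi.smul_apply, smul_eq_mul]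

lemma Dk_sum (i k : ℕ) (s : Finset ℕ) (c : ℕ → ℝ) (f : ℕ → ℝ → ℝ) (y : ℝ) :
    Dk i k (fun t => ∑ m ∈ s, c m * f m t) y = ∑ m ∈ s, c m * Dk i k (f m) y := by
  have h : (fun t => ∑ m ∈ s, c m * f m t) = ∑ m ∈ s, c m • f m := by
    funext t
    simp
  simp only [Dk_eq_dopLinear_pow, h, map_sum, map_smul, Finset.sum_apply, Pi.smul_apply,
    smul_eq_mul]

lemma fall_succ (x : ℝ) (k : ℕ) : fall x (k + 1) = fall x k * (x - k) :=
  Finset.prod_range_succ _ _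

lemma poch_succ (x : ℝ) (k : ℕ) : poch x (k + 1) = poch x k * (x + k) :=
  Finset.prod_range_succ _ _

/-- The step `⟨x⟩_i^{k+1} = ⟨x⟩_i^k (x + ε k)` uses the sign `ε = -1` for `i = 1`
and `ε = 1` for `i = 2`. -/
def stepSign (i : ℕ) : ℝ := if i = 1 then -1 else 1

lemma br_zero (i : ℕ) (x : ℝ) : br i x 0 = 1 := by
  simp [br, fall, poch]

lemma br_succ (i : ℕ) (x : ℝ) (k : ℕ) :
    br i x (k + 1) = br i x k * (x + stepSign i * k) := by
  unfold br stepSign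
  split_ifs
  · rw [fall_succ]; ring
  · rw [poch_succ]; ring

/-- Leibniz rule for iterated differences of `(x - y) g(y)`. -/
lemma Dk_succ_sub_mul (i k : ℕ) (x : ℝ) (g : ℝ → ℝ) (y : ℝ) :
    Dk i (k + 1) (fun t => (x - t) * g t) y =
      (x - y + stepSign i * (k + 1)) * Dk i (k + 1) g y - (k + 1) * Dk i k g y := by
  induction k generalizing y with
  | zero =>
    simp only [Dk, Function.iterate_succ, Function.iterate_zero, Function.comp, id, Dop, stepSign]
    split_ifs <;> push_cast <;> ring
  | succ k ih =>
    have h : Dk i (k + 1) (fun t => (x - t) * g t) = fun y =>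
        (x - y + stepSign i * (k + 1)) * Dk i (k + 1) g y - (k + 1) * Dk i k g y := funext ih
    rw [Dk_succ, h, Dk_succ i (k + 1) g]
    have h2 := congrFun (Dk_succ i k g)
    simp only [Dop, stepSign] at h2 ⊢
    split_ifs at h2 ⊢
    all_goals
      push_cast
      linear_combination (k + 1 : ℝ) * h2 y

/-- Iterated differences of a quotient `f(y) / (x - y)`, in division-free form. -/
lemma br_succ_mul_Dk (i j : ℕ) (x α : ℝ) (g : ℝ → ℝ) :
    br i (x - α) (j + 1) * Dk i j g α = (Nat.factorial j : ℝ) *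
      ∑ k ∈ Finset.range (j + 1),
        Dk i k (fun t => (x - t) * g t) α / (Nat.factorial k : ℝ) * br i (x - α) k := by
  induction j with
  | zero => simp [br_succ, br_zero, Dk]
  | succ j ih =>
    rw [Finset.sum_range_succ, mul_add, Nat.factorial_succ]
    have hj : ((j + 1 : ℕ) : ℝ) * (Nat.factorial j : ℝ) ≠ 0 := by positivity
    push_cast at hj ⊢
    rw [mul_assoc ((j : ℝ) + 1) (Nat.factorial j : ℝ), ← ih, Dk_succ_sub_mul, br_succ i _ (j + 1)]
    field_simp
    push_cast
    ring

/-- Coefficient of the falling factorial `[x]_k` in the monic Meixner polynomial. -/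
def meixnerCoeff (γ μ : ℝ) (n k : ℕ) : ℝ :=
  (n.choose k : ℝ) * poch (γ + k) (n - k) * (μ / (μ - 1)) ^ (n - k)

lemma meixnerCoeff_self (γ μ : ℝ) (n : ℕ) : meixnerCoeff γ μ n n = 1 := by
  simp [meixnerCoeff, poch]

lemma meixnerCoeff_eq_zero (γ μ : ℝ) {n k : ℕ} (h : n < k) : meixnerCoeff γ μ n k = 0 := by
  simp [meixnerCoeff, Nat.choose_eq_zero_of_lt h]

lemma poch_add (a : ℝ) (k m : ℕ) : poch a (k + m) = poch a k * poch (a + k) m := by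
  unfold poch
  rw [Finset.prod_range_add]
  congr 1
  refine Finset.prod_congr rfl fun t _ => ?_
  push_cast
  ring

lemma poch_pos {a : ℝ} (ha : 0 < a) (k : ℕ) : 0 < poch a k :=
  Finset.prod_pos fun m _ => by positivity

lemma poch_neg (x : ℝ) (k : ℕ) : poch (-x) k = (-1) ^ k * fall x k := by
  induction k with
  | zero => simp [poch, fall]
  | succ k ih => rw [poch_succ, fall_succ, ih]; ring

lemma fall_natCast (n k : ℕ) :
    fall (n : ℝ) k = (Nat.factorial k : ℝ) * (n.choose k : ℝ) := by
  rw [← Nat.cast_mul, ← Nat.descFactorial_eq_factorial_mul_choose]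
  induction k with
  | zero => simp [fall]
  | succ k ih =>
    rw [fall_succ, ih, Nat.descFactorial_succ]
    rcases le_or_gt k n with h | h
    · push_cast [h]; ring
    · simp [Nat.descFactorial_of_lt h]

lemma MeixnerM_eq_sum_fall {γ μ : ℝ} (hγ : 0 < γ) (hμ0 : 0 < μ) (hμ1 : μ < 1) (n : ℕ) (x : ℝ) :
    MeixnerM γ μ n x = ∑ k ∈ Finset.range (n + 1), meixnerCoeff γ μ n k * fall x k := by
  unfold MeixnerM
  rw [Finset.mul_sum]
  refine Finset.sum_congr rfl fun k hk => ?_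
  obtain ⟨m, rfl⟩ := Nat.exists_eq_add_of_le (Nat.lt_succ_iff.mp (Finset.mem_range.mp hk))
  have hμ : μ - 1 ≠ 0 := by linarith
  have h1 : (1 - μ⁻¹) = (μ / (μ - 1))⁻¹ := by field_simp
  have hd : μ / (μ - 1) ≠ 0 := div_ne_zero hμ0.ne' hμ
  have hp : poch γ k ≠ 0 := (poch_pos hγ k).ne'
  have hs : ((-1 : ℝ) ^ k) * (-1) ^ k = 1 := by rw [← mul_pow]; simp
  rw [h1, poch_neg, poch_neg, fall_natCast, poch_add, meixnerCoeff, Nat.add_sub_cancel_left]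
  generalize μ / (μ - 1) = d at *
  have hf : (Nat.factorial k : ℝ) ≠ 0 := by positivity
  rw [inv_pow, pow_add]
  field_simp
  linear_combination (poch (γ + k) m * ((k + m).choose k : ℝ)) * fall x k * hs

lemma MeixnerM_eq_sum_fall_of_lt {γ μ : ℝ} (hγ : 0 < γ) (hμ0 : 0 < μ) (hμ1 : μ < 1)
    {n N : ℕ} (h : n < N) (x : ℝ) :
    MeixnerM γ μ n x = ∑ k ∈ Finset.range N, meixnerCoeff γ μ n k * fall x k := by
  rw [MeixnerM_eq_sum_fall hγ hμ0 hμ1]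
  refine Finset.sum_subset (Finset.range_subset_range.mpr h) fun k _ hk => ?_
  rw [meixnerCoeff_eq_zero γ μ (by simpa using hk), zero_mul]

lemma meixnerCoeff_succ_left (γ μ : ℝ) (n k : ℕ) :
    ((n : ℝ) + 1 - k) * meixnerCoeff γ μ (n + 1) k =
      (n + 1) * (μ / (μ - 1)) * (n + γ) * meixnerCoeff γ μ n k := by
  rcases lt_trichotomy k (n + 1) with h | h | h
  · obtain ⟨m, rfl⟩ := Nat.exists_eq_add_of_le (Nat.lt_succ_iff.mp h)
    have hc : ((k + m + 1).choose k : ℝ) * (m + 1) = (k + m + 1) * ((k + m).choose k : ℝ) := by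
      have := Nat.choose_mul_succ_eq (k + m) k
      rw [show k + m + 1 - k = m + 1 by omega] at this
      have := congrArg (Nat.cast : ℕ → ℝ) this
      push_cast at this
      linarith
    unfold meixnerCoeff
    rw [show k + m + 1 - k = m + 1 by omega, Nat.add_sub_cancel_left, poch_succ]
    push_cast
    linear_combination (poch (γ + k) m * (γ + k + m) * (μ / (μ - 1)) ^ (m + 1)) * hc
  · subst h
    rw [meixnerCoeff_eq_zero γ μ (Nat.lt_succ_self n)]
    push_cast
    ring
  · rw [meixnerCoeff_eq_zero γ μ h, meixnerCoeff_eq_zero γ μ (by omega)]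
    ring

lemma meixnerCoeff_succ_right (γ μ : ℝ) (n k : ℕ) :
    ((k : ℝ) + 1) * (k + γ) * (μ / (μ - 1)) * meixnerCoeff γ μ n (k + 1) =
      (n - k) * meixnerCoeff γ μ n k := by
  rcases lt_trichotomy k n with h | h | h
  · obtain ⟨m, rfl⟩ := Nat.exists_eq_add_of_lt h
    have hc : ((k + m + 1).choose (k + 1) : ℝ) * (k + 1) = ((k + m + 1).choose k : ℝ) * (m + 1) := by
      have := Nat.choose_succ_right_eq (k + m + 1) k
      rw [show k + m + 1 - k = m + 1 by omega] at this
      exact_mod_cast this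
    unfold meixnerCoeff
    rw [show k + m + 1 - (k + 1) = m by omega, show k + m + 1 - k = 1 + m by omega, poch_add]
    have h1 : poch (γ + k) 1 = γ + k := by simp [poch]
    rw [h1, add_assoc γ (k : ℝ) ((1 : ℕ) : ℝ), pow_add, pow_one]
    push_cast
    linear_combination ((γ + k) * poch (γ + (k + 1)) m * (μ / (μ - 1)) * (μ / (μ - 1)) ^ m) * hc
  · subst h
    rw [meixnerCoeff_eq_zero γ μ (Nat.lt_succ_self k)]
    ring
  · rw [meixnerCoeff_eq_zero γ μ h, meixnerCoeff_eq_zero γ μ (by omega)]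
    ring

lemma fall_succ' (x : ℝ) (k : ℕ) : fall x (k + 1) = x * fall (x - 1) k := by
  unfold fall
  rw [Finset.prod_range_succ']
  simp only [Nat.cast_zero, sub_zero]
  rw [mul_comm]
  congr 1
  refine Finset.prod_congr rfl fun t _ => ?_
  push_cast
  ring

lemma mul_fall_sub_fall (x : ℝ) (k : ℕ) : x * (fall x k - fall (x - 1) k) = k * fall x k := by
  have h := fall_succ' x k
  rw [fall_succ] at h
  linear_combination h

lemma fall_add_one_sub (x : ℝ) (k : ℕ) :
    fall (x + 1) (k + 1) - fall x (k + 1) = (k + 1) * fall x k := by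
  rw [fall_succ', fall_succ, add_sub_cancel_right]
  ring

/-- Structure relation for the backward difference. -/
lemma MeixnerM_backward {γ μ : ℝ} (hγ : 0 < γ) (hμ0 : 0 < μ) (hμ1 : μ < 1) (n : ℕ) (x : ℝ) :
    x * (MeixnerM γ μ n x - MeixnerM γ μ n (x - 1)) =
      n * MeixnerM γ μ n x - n * (μ / (μ - 1)) * (n + γ - 1) * MeixnerM γ μ (n - 1) x := by
  rw [MeixnerM_eq_sum_fall hγ hμ0 hμ1 n x, MeixnerM_eq_sum_fall hγ hμ0 hμ1 n (x - 1),
    MeixnerM_eq_sum_fall_of_lt hγ hμ0 hμ1 (show n - 1 < n + 1 by omega),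
    ← Finset.sum_sub_distrib, Finset.mul_sum, Finset.mul_sum, Finset.mul_sum,
    ← Finset.sum_sub_distrib]
  refine Finset.sum_congr rfl fun k _ => ?_
  rcases n with _ | n
  · rcases k with _ | k
    · simp [fall]
    · rw [meixnerCoeff_eq_zero γ μ (by omega)]; simp
  · have h1 := meixnerCoeff_succ_left γ μ n k
    have h2 := mul_fall_sub_fall x k
    rw [Nat.add_sub_cancel]
    push_cast
    linear_combination meixnerCoeff γ μ (n + 1) k * h2 - fall x k * h1

/-- Structure relation for the forward difference. -/
lemma MeixnerM_forward {γ μ : ℝ} (hγ : 0 < γ) (hμ0 : 0 < μ) (hμ1 : μ < 1) (n : ℕ) (x : ℝ) :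
    (x + γ) * (MeixnerM γ μ n (x + 1) - MeixnerM γ μ n x) =
      n * MeixnerM γ μ n x + n * (n + γ - 1) / (1 - μ) * MeixnerM γ μ (n - 1) x := by
  have hΔ : (x + γ) * (MeixnerM γ μ n (x + 1) - MeixnerM γ μ n x) =
      ∑ k ∈ Finset.range (n + 1), (k : ℝ) * meixnerCoeff γ μ n k * fall x k +
        ∑ k ∈ Finset.range (n + 1),
          ((k : ℝ) + 1) * (k + γ) * meixnerCoeff γ μ n (k + 1) * fall x k := by
    have h0 : fall (x + 1) 0 = fall x 0 := by simp [fall]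
    rw [MeixnerM_eq_sum_fall hγ hμ0 hμ1 n x, MeixnerM_eq_sum_fall hγ hμ0 hμ1 n (x + 1),
      ← Finset.sum_sub_distrib, Finset.sum_range_succ',
      Finset.sum_range_succ' (fun k => (k : ℝ) * meixnerCoeff γ μ n k * fall x k),
      Finset.sum_range_succ _ n, meixnerCoeff_eq_zero γ μ (Nat.lt_succ_self n),
      h0, sub_self, add_zero, Finset.mul_sum]
    simp only [Nat.cast_zero, zero_mul, mul_zero, add_zero]
    rw [← Finset.sum_add_distrib]
    refine Finset.sum_congr rfl fun k _ => ?_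
    push_cast
    linear_combination (x + γ) * meixnerCoeff γ μ n (k + 1) * fall_add_one_sub x k
      - (k + 1) * meixnerCoeff γ μ n (k + 1) * fall_succ x k
  rw [hΔ, MeixnerM_eq_sum_fall hγ hμ0 hμ1 n x,
    MeixnerM_eq_sum_fall_of_lt hγ hμ0 hμ1 (show n - 1 < n + 1 by omega),
    Finset.mul_sum, Finset.mul_sum, ← Finset.sum_add_distrib, ← Finset.sum_add_distrib]
  refine Finset.sum_congr rfl fun k _ => ?_
  rcases n with _ | n
  · rcases k with _ | k <;> simp [meixnerCoeff_eq_zero]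
  · have h1 := meixnerCoeff_succ_left γ μ n k
    have h2 := meixnerCoeff_succ_right γ μ (n + 1) k
    have hμ : μ - 1 ≠ 0 := by linarith
    have hμ' : 1 - μ ≠ 0 := by linarith
    have hu : μ / (μ - 1) * ((μ - 1) / μ) = 1 := by field_simp
    have h4 : (1 : ℝ) / (1 - μ) = (μ / (μ - 1)) * ((μ - 1) / μ - 1) := by
      field_simp
      ring
    rw [Nat.add_sub_cancel]
    push_cast at h2 ⊢
    rw [div_eq_mul_one_div _ (1 - μ), h4]
    linear_combination ((μ - 1) / μ) * fall x k * h2 + ((μ - 1) / μ - 1) * fall x k * h1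
      - (k + 1) * (k + γ) * meixnerCoeff γ μ (n + 1) (k + 1) * fall x k * hu

/-- Three-term recurrence relation. -/
lemma MeixnerM_recurrence {γ μ : ℝ} (hγ : 0 < γ) (hμ0 : 0 < μ) (hμ1 : μ < 1) (n : ℕ) (x : ℝ) :
    MeixnerM γ μ (n + 1) x =
      (x - alphaR γ μ n) * MeixnerM γ μ n x - betaR γ μ n * MeixnerM γ μ (n - 1) x := by
  have h1 := MeixnerM_backward hγ hμ0 hμ1 (n + 1) x
  have h2 := MeixnerM_backward hγ hμ0 hμ1 n x
  have h3 := MeixnerM_forward hγ hμ0 hμ1 (n + 1) (x - 1)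
  rw [sub_add_cancel] at h3
  rw [Nat.add_sub_cancel] at h1 h3
  have hμ : 1 - μ ≠ 0 := by linarith
  have hμ' : μ - 1 ≠ 0 := by linarith
  have hd : μ / (μ - 1) = 1 - 1 / (1 - μ) := by
    field_simp
    ring
  have hα : alphaR γ μ n = n * (2 * (1 / (1 - μ)) - 1) + (1 / (1 - μ) - 1) * γ := by
    unfold alphaR
    field_simp
    ring
  have hβ : betaR γ μ n = n * (n + γ - 1) * (1 / (1 - μ) - 1) * (1 / (1 - μ)) := by
    unfold betaR
    field_simp
    ring
  have hn : ((n : ℝ) + 1) * (n + γ) ≠ 0 := by positivity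
  rw [div_eq_mul_one_div _ (1 - μ)] at h3
  push_cast at h1 h3
  rw [hα, hβ]
  rw [hd] at h1 h2
  apply mul_left_cancel₀ hn
  linear_combination x * h3 - (x - 1 + γ + (n + 1)) * h1 - (n + 1) * (n + γ) * (1 / (1 - μ)) * h2

/-- The Meixner weight `μ^x (γ)_x / x!`. -/
def meixnerWeight (γ μ : ℝ) (x : ℕ) : ℝ := μ ^ x * poch γ x / (Nat.factorial x : ℝ)

lemma meixnerWeight_pos {γ μ : ℝ} (hγ : 0 < γ) (hμ0 : 0 < μ) (x : ℕ) :
    0 < meixnerWeight γ μ x := by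
  have := poch_pos hγ x
  unfold meixnerWeight
  positivity

/-- Pearson equation for the Meixner weight. -/
lemma meixnerWeight_succ (γ μ : ℝ) (x : ℕ) :
    ((x : ℝ) + 1) * meixnerWeight γ μ (x + 1) = μ * (x + γ) * meixnerWeight γ μ x := by
  unfold meixnerWeight
  rw [poch_succ, Nat.factorial_succ]
  push_cast
  have : (Nat.factorial x : ℝ) ≠ 0 := by positivity
  field_simp
  ring

lemma summable_pow_mul_meixnerWeight {γ μ : ℝ} (hγ : 0 < γ) (hμ0 : 0 < μ) (hμ1 : μ < 1) (k : ℕ) :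
    Summable fun x : ℕ => (x : ℝ) ^ k * meixnerWeight γ μ x := by
  refine summable_of_ratio_test_tendsto_lt_one hμ1 ?_ ?_
  · filter_upwards [eventually_gt_atTop 0] with x hx
    have := meixnerWeight_pos hγ hμ0 x
    positivity
  · have h1 : Tendsto (fun x : ℕ => 1 + (1 : ℝ) / x) atTop (𝓝 (1 + 0)) :=
      tendsto_const_nhds.add tendsto_one_div_atTop_nhds_zero_nat
    have h2 : Tendsto (fun x : ℕ => 1 + (γ - 1) * ((1 : ℝ) / ((x : ℝ) + 1))) atTop
        (𝓝 (1 + (γ - 1) * 0)) :=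
      tendsto_const_nhds.add (tendsto_const_nhds.mul tendsto_one_div_add_atTop_nhds_zero_nat)
    have h3 := ((h1.pow k).mul h2).const_mul μ
    simp only [add_zero, one_pow, mul_zero, mul_one] at h3
    refine h3.congr' ?_
    filter_upwards [eventually_gt_atTop 0] with x hx
    have hw := meixnerWeight_pos hγ hμ0 x
    have hw' := meixnerWeight_pos hγ hμ0 (x + 1)
    have hs := meixnerWeight_succ γ μ x
    have hx' : (0 : ℝ) < x := by exact_mod_cast hx
    rw [Real.norm_of_nonneg (by positivity), Real.norm_of_nonneg (by positivity)]
    have hws : meixnerWeight γ μ (x + 1) = μ * (x + γ) * meixnerWeight γ μ x / (x + 1) := by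
      rw [← hs]
      field_simp
    have e1 : 1 + 1 / (x : ℝ) = (x + 1) / x := by field_simp
    have e2 : 1 + (γ - 1) * (1 / ((x : ℝ) + 1)) = (x + γ) / (x + 1) := by
      field_simp
      ring
    rw [hws, e1, e2, div_pow]
    push_cast
    field_simp

lemma summable_eval_mul_meixnerWeight {γ μ : ℝ} (hγ : 0 < γ) (hμ0 : 0 < μ) (hμ1 : μ < 1)
    (p : ℝ[X]) : Summable fun x : ℕ => p.eval (x : ℝ) * meixnerWeight γ μ x := by
  induction p using Polynomial.induction_on' with
  | add p q hp hq => simpa [add_mul] using hp.add hq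
  | monomial k c =>
    simpa [mul_assoc] using (summable_pow_mul_meixnerWeight hγ hμ0 hμ1 k).mul_left c

/-- The Meixner moment functional on polynomials. -/
def meixnerFunctional (γ μ : ℝ) (p : ℝ[X]) : ℝ := ∑' x : ℕ, p.eval (x : ℝ) * meixnerWeight γ μ x

lemma meixnerFunctional_add {γ μ : ℝ} (hγ : 0 < γ) (hμ0 : 0 < μ) (hμ1 : μ < 1) (p q : ℝ[X]) :
    meixnerFunctional γ μ (p + q) = meixnerFunctional γ μ p + meixnerFunctional γ μ q := by
  unfold meixnerFunctional
  rw [← (summable_eval_mul_meixnerWeight hγ hμ0 hμ1 p).tsum_add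
    (summable_eval_mul_meixnerWeight hγ hμ0 hμ1 q)]
  simp only [eval_add, add_mul]

lemma meixnerFunctional_C_mul (γ μ c : ℝ) (p : ℝ[X]) :
    meixnerFunctional γ μ (C c * p) = c * meixnerFunctional γ μ p := by
  unfold meixnerFunctional
  rw [← tsum_mul_left]
  simp only [eval_mul, eval_C, mul_assoc]

/-- The Meixner moment functional as a linear map. -/
def meixnerLinear {γ μ : ℝ} (hγ : 0 < γ) (hμ0 : 0 < μ) (hμ1 : μ < 1) : ℝ[X] →ₗ[ℝ] ℝ where
  toFun := meixnerFunctional γ μ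
  map_add' := meixnerFunctional_add hγ hμ0 hμ1
  map_smul' c p := by
    rw [smul_eq_C_mul, meixnerFunctional_C_mul, RingHom.id_apply, smul_eq_mul]

lemma mIP_eval (γ μ : ℝ) (p q : ℝ[X]) :
    mIP γ μ (fun x => p.eval x) (fun x => q.eval x) = meixnerFunctional γ μ (p * q) := by
  unfold mIP meixnerFunctional meixnerWeight
  refine tsum_congr fun x => ?_
  rw [eval_mul]
  ring

/-- Summation by parts for the Meixner functional. -/
lemma meixnerFunctional_X_mul {γ μ : ℝ} (hγ : 0 < γ) (hμ0 : 0 < μ) (hμ1 : μ < 1) (p : ℝ[X]) :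
    meixnerFunctional γ μ (X * p) =
      meixnerFunctional γ μ (C μ * ((X + C γ) * p.comp (X + 1))) := by
  unfold meixnerFunctional
  rw [(summable_eval_mul_meixnerWeight hγ hμ0 hμ1 (X * p)).tsum_eq_zero_add]
  simp only [eval_mul, eval_X, Nat.cast_zero, zero_mul, zero_add]
  refine tsum_congr fun x => ?_
  have := meixnerWeight_succ γ μ x
  simp only [eval_C, eval_add, eval_X, eval_comp, eval_one]
  push_cast
  linear_combination eval ((x : ℝ) + 1) p * this

lemma eval_descPochhammer (x : ℝ) (k : ℕ) : (descPochhammer ℝ k).eval x = fall x k := by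
  induction k with
  | zero => simp [fall]
  | succ k ih => rw [descPochhammer_succ_eval, ih, fall_succ]

/-- The Meixner polynomial as an element of `ℝ[X]`. -/
def meixnerPoly (γ μ : ℝ) (n : ℕ) : ℝ[X] :=
  ∑ k ∈ Finset.range (n + 1), C (meixnerCoeff γ μ n k) * descPochhammer ℝ k

lemma eval_meixnerPoly {γ μ : ℝ} (hγ : 0 < γ) (hμ0 : 0 < μ) (hμ1 : μ < 1) (n : ℕ) (x : ℝ) :
    (meixnerPoly γ μ n).eval x = MeixnerM γ μ n x := by
  rw [MeixnerM_eq_sum_fall hγ hμ0 hμ1, meixnerPoly, eval_finsetSum]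
  simp only [eval_mul, eval_C, eval_descPochhammer]

lemma degree_meixnerPoly_sub_lt (γ μ : ℝ) (n : ℕ) :
    (meixnerPoly γ μ n - descPochhammer ℝ n).degree < (n : WithBot ℕ) := by
  rw [meixnerPoly, Finset.sum_range_succ, meixnerCoeff_self, C_1, one_mul, add_sub_cancel_right,
    ← mem_degreeLT]
  refine Submodule.sum_mem _ fun k hk => mem_degreeLT.mpr ?_
  rw [← smul_eq_C_mul]
  refine (degree_smul_le _ _).trans_lt ?_
  rw [degree_eq_natDegree (monic_descPochhammer ℝ k).ne_zero, descPochhammer_natDegree]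
  exact_mod_cast Finset.mem_range.mp hk

lemma degree_descPochhammer (n : ℕ) : (descPochhammer ℝ n).degree = (n : WithBot ℕ) := by
  rw [degree_eq_natDegree (monic_descPochhammer ℝ n).ne_zero, descPochhammer_natDegree]

lemma degree_meixnerPoly (γ μ : ℝ) (n : ℕ) : (meixnerPoly γ μ n).degree = (n : WithBot ℕ) := by
  have h := degree_meixnerPoly_sub_lt γ μ n
  rw [← degree_descPochhammer n] at h
  rw [← sub_add_cancel (meixnerPoly γ μ n) (descPochhammer ℝ n),
    degree_add_eq_right_of_degree_lt h, degree_descPochhammer]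

lemma monic_meixnerPoly (γ μ : ℝ) (n : ℕ) : (meixnerPoly γ μ n).Monic := by
  have h := degree_meixnerPoly_sub_lt γ μ n
  rw [← degree_descPochhammer n] at h
  have := (monic_descPochhammer ℝ n).add_of_right h
  rwa [sub_add_cancel] at this

/-- Polynomials of degree less than `n` are combinations of the first `n` Meixner polynomials. -/
lemma exists_eq_sum_meixnerPoly (γ μ : ℝ) (n : ℕ) (p : ℝ[X]) (hp : p.degree < (n : WithBot ℕ)) :
    ∃ c : ℕ → ℝ, p = ∑ k ∈ Finset.range n, C (c k) * meixnerPoly γ μ k := by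
  induction n generalizing p with
  | zero =>
    refine ⟨0, ?_⟩
    simpa using hp
  | succ n ih =>
    have hlt : (p - C (p.coeff n) * meixnerPoly γ μ n).degree < (n : WithBot ℕ) := by
      rw [degree_lt_iff_coeff_zero] at hp ⊢
      intro m hm
      rcases hm.eq_or_lt with rfl | hm
      · have hc : (meixnerPoly γ μ n).coeff n = 1 := by
          have h1 := monic_meixnerPoly γ μ n
          rwa [Monic, leadingCoeff, natDegree_eq_of_degree_eq_some (degree_meixnerPoly γ μ n)]
            at h1
        rw [coeff_sub, coeff_C_mul, hc, mul_one, sub_self]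
      · have hz : (meixnerPoly γ μ n).coeff m = 0 := by
          apply coeff_eq_zero_of_degree_lt
          rw [degree_meixnerPoly]
          exact_mod_cast hm
        rw [coeff_sub, coeff_C_mul, hp m hm, hz, mul_zero, sub_zero]
    obtain ⟨c, hc⟩ := ih _ hlt
    refine ⟨Function.update c n (p.coeff n), ?_⟩
    rw [Finset.sum_range_succ, Function.update_self, ← sub_eq_iff_eq_add, hc]
    refine Finset.sum_congr rfl fun k hk => ?_
    rw [Function.update_of_ne (Finset.mem_range.mp hk).ne]

/-- Dirichlet form of the Meixner difference operator. -/
lemma meixnerFunctional_mul_meixnerPoly {γ μ : ℝ} (hγ : 0 < γ) (hμ0 : 0 < μ) (hμ1 : μ < 1)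
    (n : ℕ) (q : ℝ[X]) :
    n * (1 - μ) * meixnerFunctional γ μ (q * meixnerPoly γ μ n) =
      meixnerFunctional γ μ (C μ * ((X + C γ) * ((q.comp (X + 1) - q) *
        ((meixnerPoly γ μ n).comp (X + 1) - meixnerPoly γ μ n)))) := by
  set p := meixnerPoly γ μ n with hp
  have key : C (n * (1 - μ)) * (q * p) + C μ * ((X + C γ) * (q * (p.comp (X + 1) - p))) =
      X * (q * (p - p.comp (X - 1))) := by
    refine Polynomial.funext fun x => ?_
    have h1 := MeixnerM_backward hγ hμ0 hμ1 n x
    have h2 := MeixnerM_forward hγ hμ0 hμ1 n x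
    have hd : μ / (μ - 1) = -(μ * (1 / (1 - μ))) := by
      rw [mul_one_div, ← div_neg, neg_sub]
    rw [hd] at h1
    rw [div_eq_mul_one_div _ (1 - μ)] at h2
    simp only [eval_mul, eval_C, eval_add, eval_sub, eval_X, eval_comp, eval_one, hp,
      eval_meixnerPoly hγ hμ0 hμ1]
    linear_combination q.eval x * μ * h2 - q.eval x * h1
  have h := congrArg (meixnerFunctional γ μ) key
  have hc : (p.comp (X - 1)).comp (X + 1) = p := by
    rw [comp_assoc]
    simp
  rw [meixnerFunctional_X_mul hγ hμ0 hμ1, mul_comp, sub_comp, hc,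
    meixnerFunctional_add hγ hμ0 hμ1, meixnerFunctional_C_mul, ← eq_sub_iff_add_eq] at h
  rw [h, sub_eq_iff_eq_add, ← meixnerFunctional_add hγ hμ0 hμ1]
  congr 1
  ring

lemma meixnerPoly_orthogonal {γ μ : ℝ} (hγ : 0 < γ) (hμ0 : 0 < μ) (hμ1 : μ < 1) {m n : ℕ}
    (hmn : m ≠ n) : meixnerFunctional γ μ (meixnerPoly γ μ m * meixnerPoly γ μ n) = 0 := by
  have h1 := meixnerFunctional_mul_meixnerPoly hγ hμ0 hμ1 n (meixnerPoly γ μ m)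
  have h2 := meixnerFunctional_mul_meixnerPoly hγ hμ0 hμ1 m (meixnerPoly γ μ n)
  rw [mul_comm (meixnerPoly γ μ n), mul_comm (_ - meixnerPoly γ μ n), ← h1] at h2
  have h3 : ((m : ℝ) - n) * (1 - μ) ≠ 0 :=
    mul_ne_zero (sub_ne_zero.mpr (by exact_mod_cast hmn)) (by linarith)
  apply mul_left_cancel₀ h3
  linear_combination h2

lemma nrm2_eq {γ μ : ℝ} (hγ : 0 < γ) (hμ0 : 0 < μ) (hμ1 : μ < 1) (n : ℕ) :
    nrm2 γ μ n = meixnerFunctional γ μ (meixnerPoly γ μ n * meixnerPoly γ μ n) := by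
  rw [← mIP_eval, nrm2]
  simp only [eval_meixnerPoly hγ hμ0 hμ1]

lemma meixnerPoly_recurrence {γ μ : ℝ} (hγ : 0 < γ) (hμ0 : 0 < μ) (hμ1 : μ < 1) (n : ℕ) :
    X * meixnerPoly γ μ n = meixnerPoly γ μ (n + 1) +
      (C (alphaR γ μ n) * meixnerPoly γ μ n + C (betaR γ μ n) * meixnerPoly γ μ (n - 1)) := by
  refine Polynomial.funext fun x => ?_
  simp only [eval_mul, eval_C, eval_add, eval_X, eval_meixnerPoly hγ hμ0 hμ1]
  rw [MeixnerM_recurrence hγ hμ0 hμ1]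
  ring

lemma nrm2_succ {γ μ : ℝ} (hγ : 0 < γ) (hμ0 : 0 < μ) (hμ1 : μ < 1) (n : ℕ) :
    nrm2 γ μ (n + 1) = betaR γ μ (n + 1) * nrm2 γ μ n := by
  have h1 : meixnerFunctional γ μ (X * meixnerPoly γ μ n * meixnerPoly γ μ (n + 1)) =
      nrm2 γ μ (n + 1) := by
    rw [meixnerPoly_recurrence hγ hμ0 hμ1, add_mul, add_mul, mul_assoc, mul_assoc,
      meixnerFunctional_add hγ hμ0 hμ1, meixnerFunctional_add hγ hμ0 hμ1,
      meixnerFunctional_C_mul, meixnerFunctional_C_mul,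
      meixnerPoly_orthogonal hγ hμ0 hμ1 (show n ≠ n + 1 by omega),
      meixnerPoly_orthogonal hγ hμ0 hμ1 (show n - 1 ≠ n + 1 by omega), nrm2_eq hγ hμ0 hμ1]
    ring
  have h2 : meixnerFunctional γ μ (X * meixnerPoly γ μ (n + 1) * meixnerPoly γ μ n) =
      betaR γ μ (n + 1) * nrm2 γ μ n := by
    rw [meixnerPoly_recurrence hγ hμ0 hμ1, add_mul, add_mul, mul_assoc, mul_assoc,
      meixnerFunctional_add hγ hμ0 hμ1, meixnerFunctional_add hγ hμ0 hμ1,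
      meixnerFunctional_C_mul, meixnerFunctional_C_mul, Nat.add_sub_cancel,
      meixnerPoly_orthogonal hγ hμ0 hμ1 (show n + 1 + 1 ≠ n by omega),
      meixnerPoly_orthogonal hγ hμ0 hμ1 (show n + 1 ≠ n by omega), nrm2_eq hγ hμ0 hμ1]
    ring
  rw [← h1, ← h2, mul_right_comm]

lemma betaR_pos {γ μ : ℝ} (hγ : 0 < γ) (hμ0 : 0 < μ) (hμ1 : μ < 1) (n : ℕ) :
    0 < betaR γ μ (n + 1) := by
  unfold betaR
  have : (0 : ℝ) < 1 - μ := by linarith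
  push_cast
  have h : (0 : ℝ) < (n + 1) + γ - 1 := by
    have : (0 : ℝ) ≤ n := Nat.cast_nonneg n
    linarith
  positivity

lemma nrm2_pos {γ μ : ℝ} (hγ : 0 < γ) (hμ0 : 0 < μ) (hμ1 : μ < 1) (n : ℕ) : 0 < nrm2 γ μ n := by
  induction n with
  | zero =>
    rw [nrm2_eq hγ hμ0 hμ1]
    have h1 : meixnerPoly γ μ 0 = 1 := by simp [meixnerPoly, meixnerCoeff_self]
    have hs := summable_eval_mul_meixnerWeight hγ hμ0 hμ1 (1 * 1)
    rw [h1]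
    refine hs.tsum_pos (fun x => ?_) 0 ?_
    · simpa using (meixnerWeight_pos hγ hμ0 x).le
    · simpa using meixnerWeight_pos hγ hμ0 0
  | succ n ih =>
    rw [nrm2_succ hγ hμ0 hμ1]
    exact mul_pos (betaR_pos hγ hμ0 hμ1 n) ih

/-- Christoffel–Darboux formula. -/
lemma christoffel_darboux {γ μ : ℝ} (hγ : 0 < γ) (hμ0 : 0 < μ) (hμ1 : μ < 1) (n : ℕ) (x y : ℝ) :
    (x - y) * ∑ k ∈ Finset.range (n + 1), MeixnerM γ μ k x / nrm2 γ μ k * MeixnerM γ μ k y =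
      MeixnerM γ μ (n + 1) x / nrm2 γ μ n * MeixnerM γ μ n y -
        MeixnerM γ μ n x / nrm2 γ μ n * MeixnerM γ μ (n + 1) y := by
  induction n with
  | zero =>
    rw [Finset.sum_range_one, MeixnerM_recurrence hγ hμ0 hμ1 0 x,
      MeixnerM_recurrence hγ hμ0 hμ1 0 y]
    ring
  | succ n ih =>
    have hN := (nrm2_pos hγ hμ0 hμ1 n).ne'
    have hb := (betaR_pos hγ hμ0 hμ1 n).ne'
    rw [Finset.sum_range_succ, mul_add, ih, MeixnerM_recurrence hγ hμ0 hμ1 (n + 1) x,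
      MeixnerM_recurrence hγ hμ0 hμ1 (n + 1) y, nrm2_succ hγ hμ0 hμ1, Nat.add_sub_cancel]
    field_simp
    ring

lemma one_add_mul_Klm_pos {γ μ lam : ℝ} (hγ : 0 < γ) (hμ0 : 0 < μ) (hμ1 : μ < 1)
    (hlam : 0 < lam) (i j n : ℕ) (α : ℝ) : 0 < 1 + lam * Klm γ μ i j j n α α := by
  have : 0 ≤ Klm γ μ i j j n α α := Finset.sum_nonneg fun k _ =>
    div_nonneg (mul_self_nonneg _) (nrm2_pos hγ hμ0 hμ1 k).le
  positivity

/-- Expansion of the Sobolev polynomials in terms of the kernel `K_n^{(0,j)}(x,α)`. -/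
lemma IsSobolevOP.eval_eq {γ μ lam α : ℝ} (hγ : 0 < γ) (hμ0 : 0 < μ) (hμ1 : μ < 1)
    (hlam : 0 < lam) {i j n : ℕ} {Q : ℝ[X]} (hQ : IsSobolevOP γ μ lam α i j (n + 1) Q) (x : ℝ) :
    Q.eval x = MeixnerM γ μ (n + 1) x -
      lam * Dk i j (MeixnerM γ μ (n + 1)) α / (1 + lam * Klm γ μ i j j n α α) *
        ∑ k ∈ Finset.range (n + 1),
          MeixnerM γ μ k x / nrm2 γ μ k * Dk i j (MeixnerM γ μ k) α := by
  obtain ⟨hmonic, hdeg, horth⟩ := hQ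
  have hQdeg : Q.degree = ((n + 1 : ℕ) : WithBot ℕ) := by
    rw [degree_eq_natDegree hmonic.ne_zero, hdeg]
  have hlt : (Q - meixnerPoly γ μ (n + 1)).degree < ((n + 1 : ℕ) : WithBot ℕ) := by
    rw [← hQdeg]
    refine degree_sub_lt_left (by rw [hQdeg, degree_meixnerPoly]) hmonic.ne_zero ?_
    rw [hmonic.leadingCoeff, (monic_meixnerPoly γ μ (n + 1)).leadingCoeff]
  obtain ⟨c, hc⟩ := exists_eq_sum_meixnerPoly γ μ (n + 1) _ hlt
  rw [sub_eq_iff_eq_add] at hc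
  set t := Dk i j (fun x => Q.eval x) α with ht
  have hM : ∀ k, (fun x => (meixnerPoly γ μ k).eval x) = MeixnerM γ μ k := fun k =>
    funext fun x => eval_meixnerPoly hγ hμ0 hμ1 k x
  have hck : ∀ k ∈ Finset.range (n + 1),
      c k = -(lam * t) * (Dk i j (MeixnerM γ μ k) α / nrm2 γ μ k) := by
    intro k hk
    have hN := (nrm2_pos hγ hμ0 hμ1 k).ne'
    have h := horth (meixnerPoly γ μ k) (by
      rw [degree_meixnerPoly]
      exact_mod_cast Finset.mem_range.mp hk)
    rw [sIP, mIP_eval, ← ht, hM] at h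
    have hL : meixnerFunctional γ μ (Q * meixnerPoly γ μ k) = c k * nrm2 γ μ k := by
      rw [hc, add_mul, meixnerFunctional_add hγ hμ0 hμ1, meixnerPoly_orthogonal hγ hμ0 hμ1
        (Finset.mem_range.mp hk).ne', add_zero, Finset.sum_mul]
      change meixnerLinear hγ hμ0 hμ1 _ = _
      rw [map_sum, Finset.sum_eq_single_of_mem k hk]
      · change meixnerFunctional γ μ _ = _
        rw [mul_assoc, meixnerFunctional_C_mul, nrm2_eq hγ hμ0 hμ1]
      · intro m _ hmk
        change meixnerFunctional γ μ _ = _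
        rw [mul_assoc, meixnerFunctional_C_mul, meixnerPoly_orthogonal hγ hμ0 hμ1 hmk, mul_zero]
    rw [hL] at h
    field_simp
    linear_combination h
  have hev : ∀ y, Q.eval y = MeixnerM γ μ (n + 1) y - lam * t *
      ∑ k ∈ Finset.range (n + 1), Dk i j (MeixnerM γ μ k) α / nrm2 γ μ k * MeixnerM γ μ k y := by
    intro y
    rw [hc, eval_add, eval_finsetSum, eval_meixnerPoly hγ hμ0 hμ1, Finset.mul_sum,
      sub_eq_add_neg, ← Finset.sum_neg_distrib, add_comm]
    congr 1
    refine Finset.sum_congr rfl fun k hk => ?_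
    rw [eval_mul, eval_C, eval_meixnerPoly hγ hμ0 hμ1, hck k hk]
    ring
  have hK := (one_add_mul_Klm_pos hγ hμ0 hμ1 hlam i j n α).ne'
  have htval : t * (1 + lam * Klm γ μ i j j n α α) = Dk i j (MeixnerM γ μ (n + 1)) α := by
    have h1 : t = Dk i j (MeixnerM γ μ (n + 1)) α - lam * t * Klm γ μ i j j n α α := by
      conv_lhs => rw [ht, funext hev]
      rw [Dk_sub, Dk_const_mul, Dk_sum, Klm]
      congr 2
      refine Finset.sum_congr rfl fun k _ => ?_
      ring
    linear_combination h1
  rw [hev, ← htval]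
  congr 1
  rw [mul_div_assoc, mul_div_assoc, div_self hK, mul_one]
  congr 1
  refine Finset.sum_congr rfl fun k _ => ?_
  ring

/-- Connection formula `Q_n = A_{1,n} M_n + B_{1,n} M_{n-1}`. -/
lemma IsSobolevOP.eval_eq_A1_add_B1 {γ μ lam α : ℝ} (hγ : 0 < γ) (hμ0 : 0 < μ) (hμ1 : μ < 1)
    (hlam : 0 < lam) {i j n : ℕ} {Q : ℝ[X]} (hQ : IsSobolevOP γ μ lam α i j (n + 1) Q) {x : ℝ}
    (hx : br i (x - α) (j + 1) ≠ 0) :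
    Q.eval x = A1 γ μ lam α i j (n + 1) x * MeixnerM γ μ (n + 1) x +
      B1 γ μ lam α i j (n + 1) x * MeixnerM γ μ n x := by
  have hK := (one_add_mul_Klm_pos hγ hμ0 hμ1 hlam i j n α).ne'
  have hN := (nrm2_pos hγ hμ0 hμ1 n).ne'
  have hker := br_succ_mul_Dk i j x α
    (fun y => ∑ k ∈ Finset.range (n + 1), MeixnerM γ μ k x / nrm2 γ μ k * MeixnerM γ μ k y)
  simp only [christoffel_darboux hγ hμ0 hμ1, Dk_sum, Dk_sub, Dk_const_mul] at hker
  have hA : A1 γ μ lam α i j (n + 1) x = 1 -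
      lam * Nat.factorial j * Dk i j (MeixnerM γ μ (n + 1)) α /
        (nrm2 γ μ n * (1 + lam * Klm γ μ i j j n α α) * br i (x - α) (j + 1)) *
      ∑ k ∈ Finset.range (j + 1),
        Dk i k (MeixnerM γ μ n) α / Nat.factorial k * br i (x - α) k := by
    rw [A1, sub_eq_add_neg (1 : ℝ), Finset.mul_sum, Finset.mul_sum, ← Finset.sum_neg_distrib]
    congr 1
    refine Finset.sum_congr rfl fun k _ => ?_
    have hf : (Nat.factorial k : ℝ) ≠ 0 := by positivity
    rw [acoef, Nat.add_sub_cancel]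
    field_simp
  have hB : B1 γ μ lam α i j (n + 1) x =
      lam * Nat.factorial j * Dk i j (MeixnerM γ μ (n + 1)) α /
        (nrm2 γ μ n * (1 + lam * Klm γ μ i j j n α α) * br i (x - α) (j + 1)) *
      ∑ k ∈ Finset.range (j + 1),
        Dk i k (MeixnerM γ μ (n + 1)) α / Nat.factorial k * br i (x - α) k := by
    rw [B1, Finset.mul_sum, Finset.mul_sum]
    refine Finset.sum_congr rfl fun k _ => ?_
    have hf : (Nat.factorial k : ℝ) ≠ 0 := by positivity
    rw [bcoef, Nat.add_sub_cancel]
    field_simp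
  have hsplit : ∑ k ∈ Finset.range (j + 1),
      (MeixnerM γ μ (n + 1) x / nrm2 γ μ n * Dk i k (MeixnerM γ μ n) α -
        MeixnerM γ μ n x / nrm2 γ μ n * Dk i k (MeixnerM γ μ (n + 1)) α) / Nat.factorial k *
          br i (x - α) k =
      MeixnerM γ μ (n + 1) x / nrm2 γ μ n * ∑ k ∈ Finset.range (j + 1),
        Dk i k (MeixnerM γ μ n) α / Nat.factorial k * br i (x - α) k -
      MeixnerM γ μ n x / nrm2 γ μ n * ∑ k ∈ Finset.range (j + 1),
        Dk i k (MeixnerM γ μ (n + 1)) α / Nat.factorial k * br i (x - α) k := by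
    rw [Finset.mul_sum, Finset.mul_sum, ← Finset.sum_sub_distrib]
    refine Finset.sum_congr rfl fun k _ => ?_
    ring
  rw [hsplit] at hker
  rw [hQ.eval_eq hγ hμ0 hμ1 hlam, hA, hB]
  generalize ∑ k ∈ Finset.range (j + 1),
    Dk i k (MeixnerM γ μ (n + 1)) α / Nat.factorial k * br i (x - α) k = S at *
  generalize ∑ k ∈ Finset.range (j + 1),
    Dk i k (MeixnerM γ μ n) α / Nat.factorial k * br i (x - α) k = T at *
  rw [mul_comm, ← eq_div_iff hx] at hker
  rw [hker]
  field_simp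
  ring

lemma Dop_eq_sh (i : ℕ) (f : ℝ → ℝ) (x : ℝ) :
    Dop i f x = -stepSign i * (f (sh i x) - f x) := by
  unfold Dop stepSign sh
  split_ifs <;> ring

/-- Structure relations for both difference operators. -/
lemma MeixnerM_structure {γ μ : ℝ} (hγ : 0 < γ) (hμ0 : 0 < μ) (hμ1 : μ < 1) {i : ℕ}
    (hi : i = 1 ∨ i = 2) (n : ℕ) (x : ℝ) :
    (x + γ * kdelta i 1) * Dop i (MeixnerM γ μ n) x = n * MeixnerM γ μ n x +
      n * (n + γ - 1) * μ ^ kdelta i 2 / (1 - μ) * MeixnerM γ μ (n - 1) x := by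
  rcases hi with rfl | rfl
  · have h := MeixnerM_forward hγ hμ0 hμ1 n x
    simpa [kdelta, Dop] using h
  · have h := MeixnerM_backward hγ hμ0 hμ1 n x
    rw [← neg_sub 1 μ, div_neg] at h
    simp only [kdelta, Dop, OfNat.ofNat_ne_one, if_false, if_true, Real.rpow_one]
    linear_combination h

/-- The difference of `Q_n` in terms of `M_n` and `M_{n-1}`. -/
lemma IsSobolevOP.Dop_eval {γ μ lam α : ℝ} (hγ : 0 < γ) (hμ0 : 0 < μ) (hμ1 : μ < 1)
    (hlam : 0 < lam) {i j n : ℕ} (hi : i = 1 ∨ i = 2) {Q : ℝ[X]}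
    (hQ : IsSobolevOP γ μ lam α i j (n + 2) Q) {x : ℝ}
    (hx : br i (x - α) (j + 1) ≠ 0) (hx' : br i (sh i x - α) (j + 1) ≠ 0) :
    (x + γ * kdelta i 1) * Dop i (fun t => Q.eval t) x =
      C1 γ μ lam α i j (n + 2) x * MeixnerM γ μ (n + 2) x +
        D1 γ μ lam α i j (n + 2) x * MeixnerM γ μ (n + 1) x := by
  have hb := (betaR_pos hγ hμ0 hμ1 n).ne'
  have s1 := MeixnerM_structure hγ hμ0 hμ1 hi (n + 2) x
  have s2 := MeixnerM_structure hγ hμ0 hμ1 hi (n + 1) x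
  have hr : MeixnerM γ μ n x = ((x - alphaR γ μ (n + 1)) * MeixnerM γ μ (n + 1) x -
      MeixnerM γ μ (n + 2) x) / betaR γ μ (n + 1) := by
    have hrec := MeixnerM_recurrence hγ hμ0 hμ1 (n + 1) x
    rw [Nat.add_sub_cancel] at hrec
    rw [eq_div_iff hb]
    linear_combination hrec
  rw [Nat.add_sub_cancel, hr] at s2
  rw [show n + 2 - 1 = n + 1 by omega] at s1
  rw [Dop_eq_sh, hQ.eval_eq_A1_add_B1 hγ hμ0 hμ1 hlam hx,
    hQ.eval_eq_A1_add_B1 hγ hμ0 hμ1 hlam hx', C1, D1, Dop_eq_sh, Dop_eq_sh,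
    show n + 2 - 1 = n + 1 by omega]
  rw [Dop_eq_sh] at s1 s2
  push_cast at s1 s2 ⊢
  simp only [div_eq_mul_inv, mul_inv] at s1 s2 ⊢
  linear_combination A1 γ μ lam α i j (n + 2) (sh i x) * s1 +
    B1 γ μ lam α i j (n + 2) (sh i x) * s2

/-- The polynomial `Q_{n-1}` in terms of `M_n` and `M_{n-1}`. -/
lemma IsSobolevOP.eval_eq_A2_add_B2 {γ μ lam α : ℝ} (hγ : 0 < γ) (hμ0 : 0 < μ) (hμ1 : μ < 1)
    (hlam : 0 < lam) {i j n : ℕ} {Q : ℝ[X]} (hQ : IsSobolevOP γ μ lam α i j (n + 1) Q) {x : ℝ}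
    (hx : br i (x - α) (j + 1) ≠ 0) :
    Q.eval x = A2 γ μ lam α i j (n + 2) x * MeixnerM γ μ (n + 2) x +
      B2 γ μ lam α i j (n + 2) x * MeixnerM γ μ (n + 1) x := by
  have hb := (betaR_pos hγ hμ0 hμ1 n).ne'
  rw [hQ.eval_eq_A1_add_B1 hγ hμ0 hμ1 hlam hx, B2, A2, show n + 2 - 1 = n + 1 by omega,
    MeixnerM_recurrence hγ hμ0 hμ1 (n + 1) x, Nat.add_sub_cancel]
  field_simp
  ring

/-- the annihilation (lowering) operator relation. -/
theorem sobolev_lowering_operator (γ μ lam α : ℝ) (hγ : 0 < γ) (hμ0 : 0 < μ)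
    (hμ1 : μ < 1) (hlam : 0 < lam) (hα : α ≤ 0) (j i n : ℕ) (hi : i = 1 ∨ i = 2)
    (hn : 2 ≤ n) (Qn Qm : Polynomial ℝ) (hQn : IsSobolevOP γ μ lam α i j n Qn)
    (hQm : IsSobolevOP γ μ lam α i j (n - 1) Qm) (x : ℝ)
    (hbr : br i (x - α) (j + 1) ≠ 0) (hbr' : br i (sh i x - α) (j + 1) ≠ 0) :
    Thetatil γ μ lam α i j n x * Dop i (fun t => Qn.eval t) x +
        Lam γ μ lam α i j n 2 1 x * Qn.eval x =
      Lam γ μ lam α i j n 1 1 x * Qm.eval x := by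

  obtain ⟨m, rfl⟩ := Nat.exists_eq_add_of_le' hn
  rw [show m + 2 - 1 = m + 1 by omega] at hQm
  have hD := hQn.Dop_eval hγ hμ0 hμ1 hlam hi hbr hbr'
  have h1 := hQn.eval_eq_A1_add_B1 hγ hμ0 hμ1 hlam hbr
  have h2 := hQm.eval_eq_A2_add_B2 hγ hμ0 hμ1 hlam hbr
  simp only [Thetatil, Theta, Lam, Aa, Bb, Cc, Dd, if_true, OfNat.ofNat_ne_one, if_false, pow_one]
  rw [mul_right_comm, hD, h1, h2]
  ring
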